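/- Let V, v be invertible 3×3 real matrices such that P = v·V is positive counter-diagonal. Let λ₀, λ₁, λ₂ be the positive real numbers with λ₀³ = (P₁₂·P₂₁)/(P₁₀·P₂₀), λ₁³ = (P₂₀·P₀₂)/(P₂₁·P₀₁), λ₂³ = (P₀₁·P₁₀)/(P₀₂·P₁₂), and let D be the diagonal matrix with diagonal entries λ₀, λ₁, λ₂. Then there exists an invertible diagonal 3×3 real matrix C such that C·(v·V)·D = C³_f, where f is the positive real number with f³ = (P₀₁·P₁₂·P₂₀)/(P₀₂·P₁₀·P₂₁). Consequently, setting m = (V·D)⁻¹, the matrix m·V is invertible diagonal and C·v·m⁻¹ = C³_f. -/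

import Mathlib

open Matrix

/-- A 3×3 real matrix is positive counter-diagonal if its diagonal entries vanish
and its off-diagonal entries are positive. -/
def IsPosCounterDiag (P : Matrix (Fin 3) (Fin 3) ℝ) : Prop :=
  (∀ i, P i i = 0) ∧ ∀ i j, i ≠ j → 0 < P i j

/-- The standard trigonal matrix `C³_f`. -/
def stdTrigonal (f : ℝ) : Matrix (Fin 3) (Fin 3) ℝ :=
  !![0, f, 1; 1, 0, f; f, 1, 0]

lemma mul_eq_mul_mul_of_pow_three {a b x y f : ℝ} (ha : 0 < a) (hb : 0 < b) (hx : 0 < x)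
    (hy : 0 < y) (hf : 0 < f) (h : a ^ 3 * x ^ 3 = f ^ 3 * (b ^ 3 * y ^ 3)) :
    a * x = f * (b * y) :=
  (pow_left_inj₀ (by positivity) (by positivity) three_ne_zero).1 (by simpa only [mul_pow] using h)

theorem stmt_3 (V v : Matrix (Fin 3) (Fin 3) ℝ)
    (hV : IsUnit V.det) (hv : IsUnit v.det)
    (hP : IsPosCounterDiag (v * V))
    (l0 l1 l2 : ℝ) (hl0 : 0 < l0) (hl1 : 0 < l1) (hl2 : 0 < l2)
    (hl0c : l0 ^ 3 = ((v * V) 1 2 * (v * V) 2 1) / ((v * V) 1 0 * (v * V) 2 0))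
    (hl1c : l1 ^ 3 = ((v * V) 2 0 * (v * V) 0 2) / ((v * V) 2 1 * (v * V) 0 1))
    (hl2c : l2 ^ 3 = ((v * V) 0 1 * (v * V) 1 0) / ((v * V) 0 2 * (v * V) 1 2))
    (D : Matrix (Fin 3) (Fin 3) ℝ) (hD : D = Matrix.diagonal ![l0, l1, l2])
    (f : ℝ) (hf : 0 < f)
    (hf3 : f ^ 3 = ((v * V) 0 1 * (v * V) 1 2 * (v * V) 2 0) /
                   ((v * V) 0 2 * (v * V) 1 0 * (v * V) 2 1))
    (m : Matrix (Fin 3) (Fin 3) ℝ) (hm : m = (V * D)⁻¹) :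
    ∃ c : Fin 3 → ℝ, (∀ i, c i ≠ 0) ∧
      Matrix.diagonal c * (v * V) * D = stdTrigonal f ∧
      (∃ d : Fin 3 → ℝ, (∀ i, d i ≠ 0) ∧ m * V = Matrix.diagonal d) ∧
      Matrix.diagonal c * v * m⁻¹ = stdTrigonal f := by
  obtain ⟨hz, hpos⟩ := hP
  have h01 := hpos 0 1 (by decide)
  have h02 := hpos 0 2 (by decide)
  have h10 := hpos 1 0 (by decide)
  have h12 := hpos 1 2 (by decide)
  have h20 := hpos 2 0 (by decide)
  have h21 := hpos 2 1 (by decide)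
  have e0 := mul_eq_mul_mul_of_pow_three h01 h02 hl1 hl2 hf
    (by rw [hl1c, hl2c, hf3]; field_simp)
  have e1 := mul_eq_mul_mul_of_pow_three h12 h10 hl2 hl0 hf
    (by rw [hl2c, hl0c, hf3]; field_simp)
  have e2 := mul_eq_mul_mul_of_pow_three h20 h21 hl0 hl1 hf
    (by rw [hl0c, hl1c, hf3]; field_simp)
  have hDdet : IsUnit D.det := by
    rw [hD, det_diagonal, Fin.prod_univ_three]
    exact (mul_pos (mul_pos hl0 hl1) hl2).ne'.isUnit
  have hmV : m * V = diagonal ![l0⁻¹, l1⁻¹, l2⁻¹] := by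
    rw [hm, Matrix.mul_inv_rev, Matrix.mul_assoc, nonsing_inv_mul V hV, Matrix.mul_one]
    refine inv_eq_right_inv ?_
    rw [hD, diagonal_mul_diagonal, ← diagonal_one]
    congr 1
    funext i
    fin_cases i <;> simp [hl0.ne', hl1.ne', hl2.ne']
  have hminv : m⁻¹ = V * D := by
    rw [hm, nonsing_inv_nonsing_inv _ (by rw [det_mul]; exact hV.mul hDdet)]
  have key : diagonal ![((v * V) 0 2 * l2)⁻¹, ((v * V) 1 0 * l0)⁻¹, ((v * V) 2 1 * l1)⁻¹] *
      (v * V) * D = stdTrigonal f := by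
    ext i j
    rw [hD, mul_diagonal, diagonal_mul]
    fin_cases i <;> fin_cases j <;> simp only [stdTrigonal, Fin.zero_eta, Fin.mk_one,
      Fin.reduceFinMk, of_apply, cons_val, hz, mul_zero, zero_mul] <;> field_simp <;> linarith
  refine ⟨_, ?_, key, ⟨_, ?_, hmV⟩, ?_⟩
  · intro i
    fin_cases i <;> simp [hl0.ne', hl1.ne', hl2.ne', h02.ne', h10.ne', h21.ne']
  · intro i
    fin_cases i <;> simp [hl0.ne', hl1.ne', hl2.ne']
  · rw [hminv, ← key]
    simp only [Matrix.mul_assoc]
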